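/- Let G be a finite abelian group with D(G) ≥ 4 and let d ∈ Δ1(G). Then (a) ρ*(G, d) ≥ ρ(G, d); (b) there exists k0 ∈ ℕ with k0·d ∈ Δ1(G) such that ρ*(G, d) ≤ ρ(G, k0·d); consequently (c) ρ*(G, d) = max{ρ(G, k·d) : k ∈ ℕ, k·d ∈ Δ1(G)}. -/

import Mathlib

/- Common definitions: zero-sum sequences over a finite abelian group,
   sets of lengths, the system of sets of lengths, the Davenport constant,
   sets of distances, elasticities, AAPs, Δ₁(G), ρ(G,d,k), ρ(G,d), ρ*(G,d),
   cross numbers, K(G₀), K(G,d), LCN-sets, Δ*(G). -/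

open scoped Classical

section Defs

variable {G : Type*} [AddCommGroup G]

/-- The support of a sequence (multiset) over `G`. -/
def suppSet (A : Multiset G) : Set G := {g | g ∈ A}

/-- `A` is a minimal zero-sum sequence (an atom of `𝓑(G₀)`) over `G₀ ⊆ G`:
a nontrivial zero-sum sequence with terms in `G₀` such that every proper
nontrivial subsequence has nonzero sum. -/
def IsMinZeroSum (G0 : Set G) (A : Multiset G) : Prop :=
  A ≠ 0 ∧ (∀ g ∈ A, g ∈ G0) ∧ A.sum = 0 ∧
    ∀ T : Multiset G, T ≤ A → T.sum = 0 → T = 0 ∨ T = A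

/-- `B` is a zero-sum sequence over `G₀ ⊆ G` (an element of `𝓑(G₀)`). -/
def IsZeroSumSeq (G0 : Set G) (B : Multiset G) : Prop :=
  (∀ g ∈ B, g ∈ G0) ∧ B.sum = 0

/-- The set of lengths `L(B)` of a zero-sum sequence `B` over `G₀`:
all `k` such that `B` is a product of `k` atoms of `𝓑(G₀)`.
(For the trivial sequence this is `{0}`.) -/
def lengthSet (G0 : Set G) (B : Multiset G) : Set ℕ :=
  {k | ∃ U : Fin k → Multiset G, (∀ i, IsMinZeroSum G0 (U i)) ∧ B = ∑ i, U i}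

/-- The system of sets of lengths `𝓛(G₀)`. -/
def systemL (G0 : Set G) : Set (Set ℕ) :=
  {L | ∃ B : Multiset G, IsZeroSumSeq G0 B ∧ L = lengthSet G0 B}

/-- The Davenport constant `D(G)`: the maximal length of a minimal zero-sum
sequence over `G`. -/
noncomputable def davenport (G : Type*) [AddCommGroup G] : ℕ :=
  sSup {m | ∃ A : Multiset G, IsMinZeroSum (Set.univ : Set G) A ∧ Multiset.card A = m}

/-- The set of successive distances `Δ(L)` of a set `L ⊆ ℕ`. -/
def deltaOf (L : Set ℕ) : Set ℕ :=
  {d | 0 < d ∧ ∃ a, a ∈ L ∧ a + d ∈ L ∧ ∀ c ∈ L, ¬(a < c ∧ c < a + d)}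

/-- `Δ(G₀) = ⋃_{L ∈ 𝓛(G₀)} Δ(L)`. -/
def deltaG0 (G0 : Set G) : Set ℕ := ⋃ L ∈ systemL G0, deltaOf L

/-- `Δ*(G) = {min Δ(G₀) : G₀ ⊆ G with Δ(G₀) ≠ ∅}`. -/
def deltaStar (G : Type*) [AddCommGroup G] : Set ℕ :=
  {d | ∃ G0 : Set G, deltaG0 G0 ≠ ∅ ∧ d = sInf (deltaG0 G0)}

/-- The elasticity `ρ(L) = max L / min L` of a (finite) set `L ⊆ ℕ`,
with the convention `ρ({0}) = 1`. -/
noncomputable def rhoL (L : Set ℕ) : ℝ :=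
  if sInf L = 0 then 1 else ((sSup L : ℕ) : ℝ) / ((sInf L : ℕ) : ℝ)

/-- The elasticity `ρ(G₀) = sup {ρ(L) : L ∈ 𝓛(G₀)}`. -/
noncomputable def rhoG0 (G0 : Set G) : ℝ := sSup (rhoL '' systemL G0)

/-- `L` (a set of naturals) is an almost arithmetical progression (AAP)
with difference `d`, length `ℓ` and bound `M`:
`L = y + (L' ∪ {0, d, …, ℓd} ∪ L'') ⊆ y + dℤ` with `L' ⊆ [−M, −1]` and
`L'' ⊆ ℓd + [1, M]`. -/
def IsAAP (L : Set ℕ) (d ℓ M : ℕ) : Prop :=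
  ∃ (y : ℤ) (L1 L2 : Set ℤ),
    L1 ⊆ Set.Icc (-(M : ℤ)) (-1) ∧
    L2 ⊆ Set.Icc ((ℓ : ℤ) * d + 1) ((ℓ : ℤ) * d + M) ∧
    ((fun x : ℕ => (x : ℤ)) '' L) =
      (fun x => y + x) '' (L1 ∪ (fun i : ℤ => (d : ℤ) * i) '' Set.Icc (0 : ℤ) (ℓ : ℤ) ∪ L2) ∧
    (∀ x ∈ L, (d : ℤ) ∣ ((x : ℤ) - y))

/-- `Δ₁(G)`: the set of `d ∈ ℕ` such that for every `k` there is some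
`L ∈ 𝓛(G)` which is an AAP with difference `d` and length at least `k`. -/
def delta1 (G : Type*) [AddCommGroup G] : Set ℕ :=
  {d | 0 < d ∧ ∀ k : ℕ, ∃ L ∈ systemL (Set.univ : Set G), ∃ ℓ ≥ k, ∃ M : ℕ, IsAAP L d ℓ M}

/-- `ρ(G, d, k)`: the supremum of elasticities of sets of lengths of `G` which
are AAPs with difference `d` and length at least `k`. -/
noncomputable def rhoGdk (G : Type*) [AddCommGroup G] (d k : ℕ) : ℝ :=
  sSup (rhoL '' {L | L ∈ systemL (Set.univ : Set G) ∧ ∃ ℓ ≥ k, ∃ M : ℕ, IsAAP L d ℓ M})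

/-- `ρ(G, d)`: the limit of the decreasing sequence `(ρ(G, d, k))_k`,
i.e. its infimum. -/
noncomputable def rhoGd (G : Type*) [AddCommGroup G] (d : ℕ) : ℝ :=
  ⨅ k : ℕ, rhoGdk G d k

/-- `ρ*(G, d) = max {ρ(G₀) : G₀ ⊆ G non-half-factorial with d ∣ min Δ(G₀)}`. -/
noncomputable def rhoStar (G : Type*) [AddCommGroup G] (d : ℕ) : ℝ :=
  sSup {x | ∃ G0 : Set G, deltaG0 G0 ≠ ∅ ∧ d ∣ sInf (deltaG0 G0) ∧ x = rhoG0 G0}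

/-- The cross number `k(S) = Σ_{g ∈ S} 1/ord(g)` of a sequence `S`. -/
noncomputable def crossNum (S : Multiset G) : ℝ :=
  (S.map (fun g => (1 : ℝ) / (addOrderOf g))).sum

/-- `K(G₀) = max {k(A) : A ∈ 𝓐(G₀)}`, the cross number of `G₀`. -/
noncomputable def KG0 (G0 : Set G) : ℝ :=
  sSup {x | ∃ A : Multiset G, IsMinZeroSum G0 A ∧ x = crossNum A}

/-- `K(G, d) = max {K(G₀) : G₀ ⊆ G non-half-factorial with d ∣ min Δ(G₀)}`. -/
noncomputable def KGd (G : Type*) [AddCommGroup G] (d : ℕ) : ℝ :=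
  sSup {x | ∃ G0 : Set G, deltaG0 G0 ≠ ∅ ∧ d ∣ sInf (deltaG0 G0) ∧ x = KG0 G0}

/-- `G₀` is an LCN-set: `k(A) ≥ 1` for every atom `A` of `𝓑(G₀)`. -/
def IsLCN (G0 : Set G) : Prop :=
  ∀ A : Multiset G, IsMinZeroSum G0 A → 1 ≤ crossNum A

end Defs

section Helpers

variable {G : Type*} [AddCommGroup G]

theorem mem_lengthSet_iff {G0 : Set G} {B : Multiset G} {k : ℕ} :
    k ∈ lengthSet G0 B ↔ ∃ Z : Multiset (Multiset G),
      Multiset.card Z = k ∧ (∀ U ∈ Z, IsMinZeroSum G0 U) ∧ Z.sum = B := by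
  constructor
  · rintro ⟨U, hU, rfl⟩
    refine ⟨(Finset.univ : Finset (Fin k)).val.map U, by simp, ?_, rfl⟩
    intro V hV
    obtain ⟨i, -, rfl⟩ := Multiset.mem_map.1 hV
    exact hU i
  · rintro ⟨Z, rfl, hZ, rfl⟩
    induction Z using Quotient.inductionOn with
    | h l =>
      refine ⟨fun i => l.get i, fun i => hZ _ ?_, ?_⟩
      · exact Multiset.mem_coe.2 (List.get_mem l i)
      · change (l : Multiset (Multiset G)).sum = _
        rw [Multiset.sum_coe]
        have := List.sum_ofFn (f := fun i => l.get i)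
        rw [List.ofFn_get] at this
        exact this

theorem add_mem_lengthSet {G0 : Set G} {A B : Multiset G} {a b : ℕ}
    (ha : a ∈ lengthSet G0 A) (hb : b ∈ lengthSet G0 B) : a + b ∈ lengthSet G0 (A + B) := by
  rw [mem_lengthSet_iff] at *
  obtain ⟨Z, rfl, h1, rfl⟩ := ha
  obtain ⟨W, rfl, h2, rfl⟩ := hb
  refine ⟨Z + W, by simp, ?_, by simp⟩
  intro U hU
  rcases Multiset.mem_add.1 hU with h | h
  · exact h1 U h
  · exact h2 U h

theorem zero_mem_lengthSet (G0 : Set G) : 0 ∈ lengthSet G0 (0 : Multiset G) := by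
  rw [mem_lengthSet_iff]
  exact ⟨0, by simp, by simp, by simp⟩

theorem nsmul_mem_lengthSet {G0 : Set G} {A : Multiset G} {a : ℕ}
    (ha : a ∈ lengthSet G0 A) (n : ℕ) : n * a ∈ lengthSet G0 (n • A) := by
  induction n with
  | zero => simpa using zero_mem_lengthSet G0
  | succ n ih =>
    rw [Nat.succ_mul, succ_nsmul]
    exact add_mem_lengthSet ih ha

theorem lengthSet_nonempty {G0 : Set G} {B : Multiset G} (hB : IsZeroSumSeq G0 B) :
    (lengthSet G0 B).Nonempty := by
  induction hn : Multiset.card B using Nat.strong_induction_on generalizing B with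
  | _ n ih =>
    by_cases h0 : B = 0
    · subst h0
      exact ⟨0, zero_mem_lengthSet G0⟩
    by_cases hA : IsMinZeroSum G0 B
    · refine ⟨1, mem_lengthSet_iff.2 ⟨{B}, by simp, ?_, by simp⟩⟩
      intro U hU
      rw [Multiset.mem_singleton] at hU
      subst hU
      exact hA
    · have : ∃ T : Multiset G, T ≤ B ∧ T.sum = 0 ∧ T ≠ 0 ∧ T ≠ B := by
        by_contra hcon
        push Not at hcon
        refine hA ⟨h0, hB.1, hB.2, fun T h1 h2 => ?_⟩
        by_cases h3 : T = 0
        · exact Or.inl h3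
        · exact Or.inr (hcon T h1 h2 h3)
      obtain ⟨T, hT, hs, hne, hneB⟩ := this
      obtain ⟨R, rfl⟩ := Multiset.le_iff_exists_add.1 hT
      have hR : R ≠ 0 := by
        rintro rfl
        simp at hneB
      have c1 := Multiset.card_pos.2 hne
      have c2 := Multiset.card_pos.2 hR
      rw [Multiset.card_add] at hn
      have hBs := hB.2
      rw [Multiset.sum_add, hs, zero_add] at hBs
      obtain ⟨a, ha⟩ := ih (Multiset.card T) (by omega) (B := T)
        ⟨fun g hg => hB.1 g (Multiset.mem_add.2 (Or.inl hg)), hs⟩ rfl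
      obtain ⟨b, hb⟩ := ih (Multiset.card R) (by omega) (B := R)
        ⟨fun g hg => hB.1 g (Multiset.mem_add.2 (Or.inr hg)), hBs⟩ rfl
      exact ⟨a + b, add_mem_lengthSet ha hb⟩

theorem lengthSet_univ {G0 : Set G} {B : Multiset G} (hB : ∀ g ∈ B, g ∈ G0) :
    lengthSet Set.univ B = lengthSet G0 B := by
  ext k
  rw [mem_lengthSet_iff, mem_lengthSet_iff]
  constructor
  · rintro ⟨Z, h1, h2, h3⟩
    refine ⟨Z, h1, fun U hU => ⟨(h2 U hU).1, fun g hg => hB g ?_, (h2 U hU).2.2⟩, h3⟩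
    rw [← h3]
    exact Multiset.mem_of_le (Multiset.single_le_sum (fun _ _ => Multiset.zero_le _) U hU) hg
  · rintro ⟨Z, h1, h2, h3⟩
    exact ⟨Z, h1, fun U hU => ⟨(h2 U hU).1, fun g _ => trivial, (h2 U hU).2.2⟩, h3⟩

/-- crude bound on the length of atoms -/
theorem card_le_of_min [Fintype G] {R : Multiset G}
    (h : ∀ T : Multiset G, T ≤ R → T.sum = 0 → T = 0 ∨ T = R) :
    Multiset.card R ≤ Fintype.card G * Fintype.card G := by
  have hc : ∀ g : G, R.count g ≤ Fintype.card G := by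
    intro g
    by_contra hlt
    push Not at hlt
    have hle : addOrderOf g ≤ Fintype.card G := addOrderOf_le_card_univ
    have hT : Multiset.replicate (addOrderOf g) g ≤ R :=
      Multiset.le_count_iff_replicate_le.1 (by omega)
    rcases h _ hT (by simp) with h0 | h0
    · have := congrArg Multiset.card h0
      have hp := addOrderOf_pos g
      rw [Multiset.card_replicate, Multiset.card_zero] at this
      omega
    · rw [← h0, Multiset.count_replicate_self] at hlt
      omega
  calc Multiset.card R = ∑ g : G, R.count g := (Multiset.sum_count_eq_card (by simp)).symm
    _ ≤ ∑ _g : G, Fintype.card G := Finset.sum_le_sum fun g _ => hc g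
    _ = _ := by simp

theorem card_sum_le {D : ℕ} {Z : Multiset (Multiset G)}
    (h : ∀ U ∈ Z, Multiset.card U ≤ D) : Multiset.card Z.sum ≤ Multiset.card Z * D := by
  induction Z using Multiset.induction with
  | empty => simp
  | cons U Z ih =>
    rw [Multiset.sum_cons, Multiset.card_add, Multiset.card_cons, Nat.succ_mul]
    have h1 := h U (Multiset.mem_cons_self _ _)
    have h2 := ih fun V hV => h V (Multiset.mem_cons_of_mem hV)
    omega

theorem card_le_sum {Z : Multiset (Multiset G)}
    (h : ∀ U ∈ Z, U ≠ 0) : Multiset.card Z ≤ Multiset.card Z.sum := by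
  induction Z using Multiset.induction with
  | empty => simp
  | cons U Z ih =>
    rw [Multiset.sum_cons, Multiset.card_add, Multiset.card_cons]
    have h1 := Multiset.card_pos.2 (h U (Multiset.mem_cons_self _ _))
    have h2 := ih fun V hV => h V (Multiset.mem_cons_of_mem hV)
    omega

theorem length_le_card {G0 : Set G} {B : Multiset G} {k : ℕ} (hk : k ∈ lengthSet G0 B) :
    k ≤ Multiset.card B := by
  obtain ⟨Z, rfl, h2, rfl⟩ := mem_lengthSet_iff.1 hk
  exact card_le_sum fun U hU => (h2 U hU).1

theorem card_le_length [Fintype G] {G0 : Set G} {B : Multiset G} {k : ℕ}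
    (hk : k ∈ lengthSet G0 B) :
    Multiset.card B ≤ k * (Fintype.card G * Fintype.card G) := by
  obtain ⟨Z, rfl, h2, rfl⟩ := mem_lengthSet_iff.1 hk
  exact card_sum_le fun U hU => card_le_of_min (h2 U hU).2.2.2

theorem lengthSet_bdd (G0 : Set G) (B : Multiset G) : BddAbove (lengthSet G0 B) :=
  ⟨_, fun _ hk => length_le_card hk⟩

theorem exists_sub_factorization (Z : Multiset (Multiset G)) :
    ∀ Y : Multiset G, Y ≤ Z.sum → ∃ Z' ≤ Z,
      Multiset.card Z ≤ Multiset.card Z' + Multiset.card Y ∧ Z'.sum + Y ≤ Z.sum := by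
  induction Z using Multiset.induction with
  | empty =>
    intro Y hY
    exact ⟨0, le_rfl, by simp, by simpa using hY⟩
  | cons U Z ih =>
    intro Y hY
    rw [Multiset.sum_cons] at hY
    obtain ⟨Z', h1, h2, h3⟩ := ih (Y - U) (by rwa [tsub_le_iff_left])
    have hsplit : Y = Y ∩ U + (Y - U) := by
      ext g
      simp only [Multiset.count_add, Multiset.count_inter, Multiset.count_sub]
      omega
    have hcard : Multiset.card Y = Multiset.card (Y ∩ U) + Multiset.card (Y - U) := by
      rw [← Multiset.card_add, ← hsplit]
    by_cases h0 : Y ∩ U = 0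
    · refine ⟨U ::ₘ Z', Multiset.cons_le_cons U h1, ?_, ?_⟩
      · simp only [Multiset.card_cons]
        omega
      · rw [h0, zero_add] at hsplit
        rw [hsplit, Multiset.sum_cons, Multiset.sum_cons, add_assoc]
        exact add_le_add le_rfl h3
    · refine ⟨Z', h1.trans (Multiset.le_cons_self _ _), ?_, ?_⟩
      · have := Multiset.card_pos.2 h0
        simp only [Multiset.card_cons]
        omega
      · rw [Multiset.sum_cons, hsplit, add_left_comm]
        exact add_le_add Multiset.inter_le_right h3

theorem length_transfer [Fintype G] {B C : Multiset G} {m b : ℕ} (hC : C.sum = 0) (hCB : C ≤ B)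
    (hm : Multiset.card B ≤ Multiset.card C + m) (hb : b ∈ lengthSet Set.univ B) :
    ∃ c ∈ lengthSet Set.univ C, b ≤ c + m ∧ c ≤ b + m * (Fintype.card G * Fintype.card G) := by
  obtain ⟨Z, rfl, h2, rfl⟩ := mem_lengthSet_iff.1 hb
  obtain ⟨Y, hY⟩ := Multiset.le_iff_exists_add.1 hCB
  have hcY : Multiset.card Y ≤ m := by
    rw [hY, Multiset.card_add] at hm
    omega
  obtain ⟨Z', h1, h3, h4⟩ := exists_sub_factorization Z Y (by rw [hY]; simp)
  rw [hY] at h4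
  have h5 : Z'.sum ≤ C := le_of_add_le_add_right h4
  obtain ⟨F, rfl⟩ := Multiset.le_iff_exists_add.1 h5
  obtain ⟨W, rfl⟩ := Multiset.le_iff_exists_add.1 h1
  have hZ's : Z'.sum.sum = 0 := by
    have : ∀ Z' : Multiset (Multiset G), (∀ U ∈ Z', U.sum = 0) → Z'.sum.sum = 0 := by
      intro Z'
      induction Z' using Multiset.induction with
      | empty => simp
      | cons U Z' ih =>
        intro h
        rw [Multiset.sum_cons, Multiset.sum_add, h U (Multiset.mem_cons_self _ _),
          ih fun V hV => h V (Multiset.mem_cons_of_mem hV), add_zero]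
    exact this Z' fun U hU => (h2 U (Multiset.mem_add.2 (Or.inl hU))).2.2.1
  rw [Multiset.sum_add, hZ's, zero_add] at hC
  obtain ⟨f, hf⟩ := lengthSet_nonempty (G0 := Set.univ) (B := F) ⟨fun _ _ => trivial, hC⟩
  have hZ' : Multiset.card Z' ∈ lengthSet Set.univ Z'.sum :=
    mem_lengthSet_iff.2 ⟨Z', rfl, fun U hU => h2 U (Multiset.mem_add.2 (Or.inl hU)), rfl⟩
  refine ⟨_, add_mem_lengthSet hZ' hf, ?_, ?_⟩
  · omega
  · have hW : Multiset.card W ≤ m := by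
      rw [Multiset.card_add] at h3
      omega
    have e1 := length_le_card hf
    have e2 : Multiset.card W.sum ≤ Multiset.card W * (Fintype.card G * Fintype.card G) :=
      card_sum_le fun U hU => card_le_of_min (h2 U (Multiset.mem_add.2 (Or.inr hU))).2.2.2
    have e3 := congrArg Multiset.card hY
    simp only [Multiset.sum_add, Multiset.card_add] at e3 ⊢
    have e4 : Multiset.card W * (Fintype.card G * Fintype.card G)
      ≤ m * (Fintype.card G * Fintype.card G) := Nat.mul_le_mul_right _ hW
    omega

theorem exists_zeroSum_sub [Fintype G] (C : Multiset G) : ∃ C' ≤ C, C'.sum = 0 ∧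
    Multiset.card C ≤ Multiset.card C' + Fintype.card G * Fintype.card G := by
  induction hn : Multiset.card C using Nat.strong_induction_on generalizing C with
  | _ n ih =>
    by_cases h : ∀ T : Multiset G, T ≤ C → T.sum = 0 → T = 0 ∨ T = C
    · refine ⟨0, Multiset.zero_le _, by simp, ?_⟩
      have := card_le_of_min h
      simp
      omega
    · push Not at h
      obtain ⟨T, hT, hs, hne, -⟩ := h
      obtain ⟨R, rfl⟩ := Multiset.le_iff_exists_add.1 hT
      have c1 := Multiset.card_pos.2 hne
      rw [Multiset.card_add] at hn
      obtain ⟨R', h1, h2, h3⟩ := ih (Multiset.card R) (by omega) R rfl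
      refine ⟨T + R', add_le_add le_rfl h1, by simp [hs, h2], ?_⟩
      rw [Multiset.card_add]
      omega

theorem extract [Fintype G] (B : ℕ → Multiset G) : ∃ (G0 : Finset G) (m : ℕ), ∀ N, ∃ k ≥ N,
    (∀ g ∉ G0, (B k).count g ≤ m) ∧ ∀ g ∈ G0, N ≤ (B k).count g := by
  let P : Finset G → Prop := fun G0 => ∀ N, ∃ k ≥ N, ∀ g ∈ G0, N ≤ (B k).count g
  have hP : (Finset.univ.filter P : Finset (Finset G)).Nonempty :=
    ⟨∅, by simp only [Finset.mem_filter, Finset.mem_univ, true_and]; exact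
      fun N => ⟨N, le_rfl, by simp⟩⟩
  obtain ⟨G0, hG0, hmax⟩ := Finset.exists_max_image _ Finset.card hP
  simp only [Finset.mem_filter, Finset.mem_univ, true_and] at hG0 hmax
  have hN : ∀ g : G, ∃ Ng, g ∉ G0 → ∀ k ≥ Ng, ∃ h ∈ insert g G0, (B k).count h < Ng := by
    intro g
    by_cases hg : g ∈ G0
    · exact ⟨0, fun h => absurd hg h⟩
    · by_contra hcon
      push Not at hcon
      have : P (insert g G0) := fun N => (hcon N).2
      have := hmax _ this
      rw [Finset.card_insert_of_notMem hg] at this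
      omega
  choose n hn using hN
  refine ⟨G0, ∑ g, n g, fun N => ?_⟩
  obtain ⟨k, hk, hk2⟩ := hG0 (max N (∑ g, n g))
  refine ⟨k, (le_max_left _ _).trans hk, fun g hg => ?_, fun g hg =>
    (le_max_left _ _).trans (hk2 g hg)⟩
  have hle : n g ≤ ∑ g, n g := Finset.single_le_sum (fun _ _ => Nat.zero_le _) (Finset.mem_univ g)
  obtain ⟨h, hh, hlt⟩ := hn g hg k (hle.trans ((le_max_right _ _).trans hk))
  rcases Finset.mem_insert.1 hh with rfl | hh
  · omega
  · have := (le_max_right _ _).trans (hk2 h hh)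
    omega

theorem deltaOf_nonempty {L : Set ℕ} {a b : ℕ} (ha : a ∈ L) (hb : b ∈ L) (hab : a < b) :
    ∃ d, d ∈ deltaOf L := by
  have hex : ∃ c, c ∈ L ∧ a < c := ⟨b, hb, hab⟩
  have h := Nat.find_spec hex
  refine ⟨Nat.find hex - a, by omega, a, ha, ?_, ?_⟩
  · rw [Nat.add_sub_cancel' h.2.le]
    exact h.1
  · rintro c hc ⟨h1, h2⟩
    have := Nat.find_min hex (m := c) (by omega)
    exact this ⟨hc, h1⟩

theorem mem_deltaG0 {G0 : Set G} {e : ℕ} : e ∈ deltaG0 G0 ↔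
    ∃ B, IsZeroSumSeq G0 B ∧ e ∈ deltaOf (lengthSet G0 B) := by
  simp only [deltaG0, systemL, Set.mem_iUnion, Set.mem_ofPred_eq]
  constructor
  · rintro ⟨L, ⟨B, hB, rfl⟩, h⟩
    exact ⟨B, hB, h⟩
  · rintro ⟨B, hB, h⟩
    exact ⟨_, ⟨B, hB, rfl⟩, h⟩

/-- elasticities are nonneg and bounded -/
theorem rhoL_bounds [Fintype G] {G0 : Set G} {B : Multiset G} (hB : IsZeroSumSeq G0 B) :
    1 ≤ rhoL (lengthSet G0 B) ∧
      rhoL (lengthSet G0 B) ≤ ((Fintype.card G * Fintype.card G : ℕ) : ℝ) := by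
  have hne := lengthSet_nonempty hB
  have h1 := Nat.sInf_mem hne
  have h2 := Nat.sSup_mem hne (lengthSet_bdd G0 B)
  unfold rhoL
  split_ifs with h0
  · refine ⟨le_rfl, ?_⟩
    have : 0 < Fintype.card G * Fintype.card G := Nat.mul_pos Fintype.card_pos Fintype.card_pos
    exact_mod_cast this
  · have hpos : (0 : ℝ) < (sInf (lengthSet G0 B) : ℕ) := by
      exact_mod_cast Nat.pos_of_ne_zero h0
    constructor
    · rw [le_div_iff₀ hpos, one_mul]
      exact_mod_cast Nat.sInf_le h2
    · rw [div_le_iff₀ hpos]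
      have := (length_le_card h2).trans (card_le_length h1)
      rw [mul_comm] at this
      exact_mod_cast this

theorem rhoG0_bdd [Fintype G] (G0 : Set G) : BddAbove (rhoL '' systemL G0) := by
  refine ⟨((Fintype.card G * Fintype.card G : ℕ) : ℝ), ?_⟩
  rintro _ ⟨_, ⟨B, hB, rfl⟩, rfl⟩
  exact (rhoL_bounds hB).2

theorem le_rhoG0_mul [Fintype G] {G0 : Set G} {C : Multiset G} (hC : IsZeroSumSeq G0 C)
    {c1 c2 : ℕ} (h1 : c1 ∈ lengthSet G0 C) (h2 : c2 ∈ lengthSet G0 C) :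
    (c1 : ℝ) ≤ rhoG0 G0 * c2 := by
  have hne := lengthSet_nonempty hC
  have hmem : rhoL (lengthSet G0 C) ≤ rhoG0 G0 :=
    le_csSup (rhoG0_bdd G0) ⟨_, ⟨C, hC, rfl⟩, rfl⟩
  have hi := Nat.sInf_mem hne
  have hge1 := (rhoL_bounds hC).1
  have hsup : c1 ≤ sSup (lengthSet G0 C) := le_csSup (lengthSet_bdd G0 C) h1
  have hinf : sInf (lengthSet G0 C) ≤ c2 := Nat.sInf_le h2
  by_cases h0 : sInf (lengthSet G0 C) = 0
  · rw [h0] at hi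
    have e1 := card_le_length hi
    have e2 := length_le_card h1
    have : c1 = 0 := by
      rw [zero_mul] at e1
      omega
    rw [this, Nat.cast_zero]
    exact mul_nonneg (by linarith) (Nat.cast_nonneg _)
  · have hpos : (0 : ℝ) < (sInf (lengthSet G0 C) : ℕ) := by
      exact_mod_cast Nat.pos_of_ne_zero h0
    have hr : rhoL (lengthSet G0 C) * (sInf (lengthSet G0 C) : ℕ) = (sSup (lengthSet G0 C) : ℕ) := by
      rw [rhoL, if_neg h0]
      field_simp
    calc (c1 : ℝ) ≤ (sSup (lengthSet G0 C) : ℕ) := by exact_mod_cast hsup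
      _ = rhoL (lengthSet G0 C) * (sInf (lengthSet G0 C) : ℕ) := hr.symm
      _ ≤ rhoG0 G0 * c2 := by
        have : ((sInf (lengthSet G0 C) : ℕ) : ℝ) ≤ c2 := by exact_mod_cast hinf
        exact mul_le_mul hmem this hpos.le (by linarith)

theorem key [Fintype G] (d : ℕ) (B : ℕ → Multiset G) (hB : ∀ k, (B k).sum = 0)
    (hcl : ∀ k, ∀ a ∈ lengthSet Set.univ (B k), ∀ b ∈ lengthSet Set.univ (B k),
      (d : ℤ) ∣ (b : ℤ) - a)
    (hlong : ∀ k, ∃ a ∈ lengthSet Set.univ (B k), ∃ b ∈ lengthSet Set.univ (B k), a + k ≤ b) :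
    ∃ G0 : Set G, deltaG0 G0 ≠ ∅ ∧ d ∣ sInf (deltaG0 G0) ∧ ∃ C : ℝ, ∀ N : ℕ, ∃ k ≥ N,
      ∀ b1 ∈ lengthSet Set.univ (B k), ∀ b2 ∈ lengthSet Set.univ (B k),
        (b1 : ℝ) ≤ rhoG0 G0 * b2 + C := by
  obtain ⟨G0, m, hext⟩ := extract B
  set D := Fintype.card G * Fintype.card G with hD
  set M := Fintype.card G * m + D with hM
  -- the approximating subsequence
  have happ : ∀ k, (∀ g ∉ G0, (B k).count g ≤ m) → ∃ C : Multiset G,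
      IsZeroSumSeq (G0 : Set G) C ∧ ∀ b ∈ lengthSet Set.univ (B k),
        ∃ c ∈ lengthSet (G0 : Set G) C, b ≤ c + M ∧ c ≤ b + M * D := by
    intro k hk
    obtain ⟨C, hC1, hC2, hC3⟩ := exists_zeroSum_sub ((B k).filter (· ∈ G0))
    have hmemC : ∀ g ∈ C, g ∈ (G0 : Set G) := fun g hg =>
      (Multiset.mem_filter.1 (Multiset.mem_of_le hC1 hg)).2
    refine ⟨C, ⟨hmemC, hC2⟩, fun b hb => ?_⟩
    rw [← lengthSet_univ hmemC]
    have hS : Multiset.card ((B k).filter (fun g => ¬ g ∈ G0)) ≤ Fintype.card G * m := by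
      calc _ = ∑ g : G, ((B k).filter (fun g => ¬ g ∈ G0)).count g :=
            (Multiset.sum_count_eq_card (by simp)).symm
        _ ≤ ∑ _g : G, m := by
            refine Finset.sum_le_sum fun g _ => ?_
            rw [Multiset.count_filter]
            by_cases h : g ∈ G0
            · simp [h]
            · simpa [h] using hk g h
        _ = _ := by simp
    have hadd := congrArg Multiset.card (Multiset.filter_add_not (· ∈ G0) (B k))
    rw [Multiset.card_add] at hadd
    exact length_transfer hC2 (hC1.trans (Multiset.filter_le _ _)) (by omega) hb
  have hnhf : deltaG0 (G0 : Set G) ≠ ∅ := by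
    intro hemp
    obtain ⟨k, hk, hk1, -⟩ := hext (M + M * D + 1)
    obtain ⟨C, hC, hC'⟩ := happ k hk1
    obtain ⟨a, ha, b, hb, hab⟩ := hlong k
    obtain ⟨c2, hc2, -, h2⟩ := hC' a ha
    obtain ⟨c1, hc1, h1, -⟩ := hC' b hb
    have hlt : c2 < c1 := by omega
    obtain ⟨e, he⟩ := deltaOf_nonempty hc2 hc1 hlt
    have : e ∈ deltaG0 (G0 : Set G) := mem_deltaG0.2 ⟨C, hC, he⟩
    rw [hemp] at this
    exact this
  refine ⟨G0, hnhf, ?_, (M : ℝ) + rhoG0 (G0 : Set G) * (M * D : ℕ), fun N => ?_⟩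
  · have hmin := Nat.sInf_mem (Set.nonempty_iff_ne_empty.2 hnhf)
    obtain ⟨A, hA, -, a, ha, had, -⟩ := mem_deltaG0.1 hmin
    obtain ⟨k, -, -, hk⟩ := hext (Multiset.card A)
    have hle : A ≤ B k := by
      rw [Multiset.le_iff_count]
      intro g
      by_cases hg : g ∈ A
      · exact (Multiset.count_le_card g A).trans (hk g (hA.1 g hg))
      · rw [Multiset.count_eq_zero_of_notMem hg]
        exact Nat.zero_le _
    obtain ⟨R, hR⟩ := Multiset.le_iff_exists_add.1 hle
    have hRs : R.sum = 0 := by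
      have := hB k
      rwa [hR, Multiset.sum_add, hA.2, zero_add] at this
    obtain ⟨r, hr⟩ := lengthSet_nonempty (G0 := Set.univ) (B := R) ⟨fun _ _ => trivial, hRs⟩
    rw [← lengthSet_univ hA.1] at ha had
    have h1 := add_mem_lengthSet ha hr
    have h2 := add_mem_lengthSet had hr
    rw [← hR] at h1 h2
    have := hcl k _ h1 _ h2
    push_cast at this
    ring_nf at this
    exact_mod_cast this
  · obtain ⟨k, hk, hk1, -⟩ := hext N
    obtain ⟨C, hC, hC'⟩ := happ k hk1
    refine ⟨k, hk, fun b1 hb1 b2 hb2 => ?_⟩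
    obtain ⟨c1, hc1, h1, -⟩ := hC' b1 hb1
    obtain ⟨c2, hc2, -, h2⟩ := hC' b2 hb2
    have h3 := le_rhoG0_mul hC hc1 hc2
    have hge : 0 ≤ rhoG0 (G0 : Set G) :=
      le_trans (le_trans zero_le_one (rhoL_bounds hC).1)
        (le_csSup (rhoG0_bdd _) ⟨_, ⟨C, hC, rfl⟩, rfl⟩)
    have h1' : (b1 : ℝ) ≤ c1 + M := by exact_mod_cast h1
    have h2' : (c2 : ℝ) ≤ b2 + (M * D : ℕ) := by exact_mod_cast h2
    have := mul_le_mul_of_nonneg_left h2' hge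
    rw [mul_add] at this
    linarith

theorem IsAAP.facts {L : Set ℕ} {d ℓ M : ℕ} (h : IsAAP L d ℓ M) :
    (∀ a ∈ L, ∀ b ∈ L, (d : ℤ) ∣ (b : ℤ) - a) ∧ ∃ a ∈ L, ∃ b ∈ L, a + ℓ * d = b := by
  obtain ⟨y, L1, L2, h1, h2, h3, h4⟩ := h
  constructor
  · intro a ha b hb
    have := dvd_sub (h4 b hb) (h4 a ha)
    simpa using this
  · have key : ∀ i : ℤ, 0 ≤ i → i ≤ ℓ → ∃ a ∈ L, (a : ℤ) = y + d * i := by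
      intro i hi hi2
      have : y + (d : ℤ) * i ∈ ((fun x : ℕ => (x : ℤ)) '' L) := by
        rw [h3]
        exact ⟨_, Or.inl (Or.inr ⟨i, ⟨hi, hi2⟩, rfl⟩), rfl⟩
      obtain ⟨a, ha, hy⟩ := this
      exact ⟨a, ha, hy⟩
    obtain ⟨a, ha, ea⟩ := key 0 le_rfl (by positivity)
    obtain ⟨b, hb, eb⟩ := key ℓ (by positivity) le_rfl
    refine ⟨a, ha, b, hb, ?_⟩
    zify
    rw [ea, eb]
    ring

theorem isAAP_of {L : Set ℕ} {d ℓ y K : ℕ} (hd : 0 < d)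
    (hL : ∀ x ∈ L, x ≤ K) (hrun : ∀ i ≤ ℓ, y + i * d ∈ L)
    (hcl : ∀ x ∈ L, (d : ℤ) ∣ (x : ℤ) - y) : ∃ M, IsAAP L d ℓ M := by
  refine ⟨y + K, y, {z | z < 0 ∧ ∃ x ∈ L, (x : ℤ) = y + z},
    {z | (ℓ : ℤ) * d < z ∧ ∃ x ∈ L, (x : ℤ) = y + z}, ?_, ?_, ?_, hcl⟩
  · rintro z ⟨hz, x, hx, e⟩
    constructor
    · push_cast
      omega
    · omega
  · rintro z ⟨hz, x, hx, e⟩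
    have := hL x hx
    have hpos : (0 : ℤ) ≤ (ℓ : ℤ) * d := by positivity
    constructor
    · omega
    · push_cast
      omega
  · ext w
    constructor
    · rintro ⟨x, hx, rfl⟩
      refine ⟨(x : ℤ) - y, ?_, by simp⟩
      by_cases h1 : (x : ℤ) - y < 0
      · exact Or.inl (Or.inl ⟨h1, x, hx, by ring⟩)
      by_cases h2 : (ℓ : ℤ) * d < (x : ℤ) - y
      · exact Or.inr ⟨h2, x, hx, by ring⟩
      · refine Or.inl (Or.inr ?_)
        obtain ⟨i, hi⟩ := hcl x hx
        refine ⟨i, ⟨?_, ?_⟩, hi.symm⟩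
        · push Not at h1
          rw [hi] at h1
          exact nonneg_of_mul_nonneg_right h1 (by exact_mod_cast hd)
        · push Not at h2
          rw [hi, mul_comm] at h2
          exact le_of_mul_le_mul_right h2 (by exact_mod_cast hd)
    · rintro ⟨z, (⟨h, x, hx, e⟩ | ⟨i, ⟨hi, hi2⟩, rfl⟩) | ⟨h, x, hx, e⟩, rfl⟩
      · exact ⟨x, hx, e⟩
      · lift i to ℕ using hi
        refine ⟨_, hrun i (by exact_mod_cast hi2), ?_⟩
        push_cast
        ring
      · exact ⟨x, hx, e⟩

/-- `min Δ(G₀)` divides all differences of lengths. -/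
theorem min_delta_dvd {G0 : Set G} (hne : deltaG0 G0 ≠ ∅) {A : Multiset G}
    (hA : IsZeroSumSeq G0 A) {a b : ℕ} (ha : a ∈ lengthSet G0 A) (hb : b ∈ lengthSet G0 A) :
    ((sInf (deltaG0 G0) : ℕ) : ℤ) ∣ (b : ℤ) - a := by
  let H : AddSubgroup ℤ :=
    { carrier := {z | ∃ A, IsZeroSumSeq G0 A ∧ ∃ a ∈ lengthSet G0 A, ∃ b ∈ lengthSet G0 A,
        z = (b : ℤ) - a}
      add_mem' := by
        rintro _ _ ⟨A, hA, a, ha, b, hb, rfl⟩ ⟨A', hA', a', ha', b', hb', rfl⟩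
        refine ⟨A + A', ⟨?_, by simp [hA.2, hA'.2]⟩, _, add_mem_lengthSet ha ha', _,
          add_mem_lengthSet hb hb', by push_cast; ring⟩
        intro g hg
        rcases Multiset.mem_add.1 hg with h | h
        · exact hA.1 g h
        · exact hA'.1 g h
      zero_mem' := ⟨0, ⟨by simp, by simp⟩, 0, zero_mem_lengthSet G0, 0, zero_mem_lengthSet G0,
        by simp⟩
      neg_mem' := by
        rintro _ ⟨A, hA, a, ha, b, hb, rfl⟩
        exact ⟨A, hA, b, hb, a, ha, by ring⟩ }
  obtain ⟨g, hg⟩ := Int.subgroup_cyclic H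
  have hdvd : ∀ z, z ∈ H ↔ g ∣ z := by
    intro z
    rw [hg, AddSubgroup.mem_closure_singleton]
    constructor
    · rintro ⟨n, rfl⟩
      simp
    · rintro ⟨n, rfl⟩
      exact ⟨n, by simp [mul_comm]⟩
  have hmin := Nat.sInf_mem (Set.nonempty_iff_ne_empty.2 hne)
  obtain ⟨A0, hA0, hpos, a0, ha0, had0, -⟩ := mem_deltaG0.1 hmin
  have hmH : ((sInf (deltaG0 G0) : ℕ) : ℤ) ∈ H :=
    ⟨A0, hA0, a0, ha0, _, had0, by push_cast; ring⟩
  have hgm := (hdvd _).1 hmH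
  have hg0 : g ≠ 0 := by
    rintro rfl
    rw [zero_dvd_iff] at hgm
    have : (sInf (deltaG0 G0)) = 0 := by exact_mod_cast hgm
    omega
  have hnpos : 0 < g.natAbs := Int.natAbs_pos.2 hg0
  have hgH : ((g.natAbs : ℕ) : ℤ) ∈ H := (hdvd _).2 (Int.dvd_natAbs.2 dvd_rfl)
  obtain ⟨A1, hA1, a1, ha1, b1, hb1, e1⟩ := hgH
  have hΔ : g.natAbs ∈ deltaG0 G0 := by
    refine mem_deltaG0.2 ⟨A1, hA1, hnpos, a1, ha1, ?_, ?_⟩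
    · have : a1 + g.natAbs = b1 := by omega
      rwa [this]
    · rintro c hc ⟨h1, h2⟩
      have hcH : ((c : ℤ) - a1) ∈ H := ⟨A1, hA1, a1, ha1, c, hc, rfl⟩
      have := Int.natAbs_dvd.2 ((hdvd _).1 hcH)
      have := Int.le_of_dvd (by omega) this
      omega
  have hle : sInf (deltaG0 G0) ≤ g.natAbs := Nat.sInf_le hΔ
  have hge : g.natAbs ≤ sInf (deltaG0 G0) :=
    Nat.le_of_dvd hpos (by exact_mod_cast Int.natAbs_dvd.2 hgm)
  have heq : sInf (deltaG0 G0) = g.natAbs := le_antisymm hle hge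
  rw [heq, Int.natAbs_dvd]
  exact (hdvd _).1 ⟨A, hA, a, ha, b, hb, rfl⟩

theorem rhoGdk_bdd [Fintype G] (d k : ℕ) : BddAbove
    (rhoL '' {L | L ∈ systemL (Set.univ : Set G) ∧ ∃ ℓ ≥ k, ∃ M : ℕ, IsAAP L d ℓ M}) :=
  (rhoG0_bdd Set.univ).mono (Set.image_mono fun _ h => h.1)

theorem systemL_nonneg [Fintype G] {G0 : Set G} {L : Set ℕ} (h : L ∈ systemL G0) :
    0 ≤ rhoL L := by
  obtain ⟨B, hB, rfl⟩ := h
  exact zero_le_one.trans (rhoL_bounds hB).1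

theorem rhoG0_nonneg [Fintype G] (G0 : Set G) : 0 ≤ rhoG0 G0 := by
  refine Real.sSup_nonneg ?_
  rintro _ ⟨L, hL, rfl⟩
  exact systemL_nonneg hL

theorem rhoGdk_nonneg [Fintype G] (d k : ℕ) : 0 ≤ rhoGdk G d k := by
  refine Real.sSup_nonneg ?_
  rintro _ ⟨L, hL, rfl⟩
  exact systemL_nonneg hL.1

theorem rhoStar_finite [Fintype G] (d : ℕ) :
    {x : ℝ | ∃ G0 : Set G, deltaG0 G0 ≠ ∅ ∧ d ∣ sInf (deltaG0 G0) ∧ x = rhoG0 G0}.Finite := by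
  refine (Set.finite_range (rhoG0 (G := G))).subset ?_
  rintro _ ⟨G0, -, -, rfl⟩
  exact ⟨G0, rfl⟩

theorem rhoStar_nonneg [Fintype G] (d : ℕ) : 0 ≤ rhoStar G d := by
  refine Real.sSup_nonneg ?_
  rintro _ ⟨G0, -, -, rfl⟩
  exact rhoG0_nonneg G0

theorem rhoStar_nonempty [Fintype G] {d : ℕ} (hd : d ∈ delta1 G) :
    {x : ℝ | ∃ G0 : Set G, deltaG0 G0 ≠ ∅ ∧ d ∣ sInf (deltaG0 G0) ∧ x = rhoG0 G0}.Nonempty := by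
  obtain ⟨hd0, h⟩ := hd
  have : ∀ k : ℕ, ∃ B : Multiset G, B.sum = 0 ∧ ∃ ℓ ≥ k, ∃ M,
      IsAAP (lengthSet Set.univ B) d ℓ M := by
    intro k
    obtain ⟨_, ⟨B, hB, rfl⟩, h'⟩ := h k
    exact ⟨B, hB.2, h'⟩
  choose B hB ℓ hℓ M hM using this
  obtain ⟨G0, h1, h2, -⟩ := key d B hB (fun k => (hM k).facts.1) (fun k => by
    obtain ⟨a, ha, b, hb, e⟩ := (hM k).facts.2
    have := Nat.le_mul_of_pos_right (ℓ k) hd0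
    have := hℓ k
    exact ⟨a, ha, b, hb, by omega⟩)
  exact ⟨_, G0, h1, h2, rfl⟩

theorem part_a [Fintype G] {d : ℕ} (hd0 : 0 < d) : rhoGd G d ≤ rhoStar G d := by
  by_contra hlt
  push Not at hlt
  obtain ⟨r, hr1, hr2⟩ := exists_between hlt
  have hbb : BddBelow (Set.range fun k => rhoGdk G d k) :=
    ⟨0, by rintro _ ⟨k, rfl⟩; exact rhoGdk_nonneg d k⟩
  have : ∀ k : ℕ, ∃ B : Multiset G, B.sum = 0 ∧ r < rhoL (lengthSet Set.univ B) ∧ ∃ ℓ ≥ k, ∃ M,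
      IsAAP (lengthSet Set.univ B) d ℓ M := by
    intro k
    have h1 : r < rhoGdk G d k := hr2.trans_le (ciInf_le hbb k)
    have hne : (rhoL '' {L | L ∈ systemL (Set.univ : Set G) ∧
        ∃ ℓ ≥ k, ∃ M : ℕ, IsAAP L d ℓ M}).Nonempty := by
      by_contra hemp
      rw [Set.not_nonempty_iff_eq_empty] at hemp
      rw [rhoGdk, hemp, Real.sSup_empty] at h1
      have := rhoStar_nonneg (G := G) d
      linarith
    obtain ⟨_, ⟨_, ⟨⟨B, hB, rfl⟩, h'⟩, rfl⟩, h2⟩ := exists_lt_of_lt_csSup hne h1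
    exact ⟨B, hB.2, h2, h'⟩
  choose B hB hrho ℓ hℓ M hM using this
  have hlong : ∀ k, ∃ a ∈ lengthSet Set.univ (B k), ∃ b ∈ lengthSet Set.univ (B k),
      a + k ≤ b := by
    intro k
    obtain ⟨a, ha, b, hb, e⟩ := (hM k).facts.2
    have := Nat.le_mul_of_pos_right (ℓ k) hd0
    have := hℓ k
    exact ⟨a, ha, b, hb, by omega⟩
  obtain ⟨G0, h1, h2, C, hC⟩ := key d B hB (fun k => (hM k).facts.1) hlong
  have hG0 : rhoG0 G0 ≤ rhoStar G d :=
    le_csSup (rhoStar_finite d).bddAbove ⟨G0, h1, h2, rfl⟩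
  set D := Fintype.card G * Fintype.card G with hD
  obtain ⟨N, hN⟩ := exists_nat_gt (C * D / (r - rhoStar G d))
  obtain ⟨k, hk, hk2⟩ := hC (N + 1)
  set L := lengthSet Set.univ (B k) with hL
  have hne : L.Nonempty := lengthSet_nonempty ⟨fun _ _ => trivial, hB k⟩
  have hi := Nat.sInf_mem hne
  have hs := Nat.sSup_mem hne (lengthSet_bdd Set.univ (B k))
  have h3 := hk2 _ hs _ hi
  obtain ⟨a, ha, b, hb, hab⟩ := hlong k
  have hkD : k ≤ sInf L * D := by
    have e1 := length_le_card hb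
    have e2 := card_le_length hi
    rw [← hD] at e2
    omega
  have hi0 : sInf L ≠ 0 := by
    intro h0
    rw [h0, zero_mul] at hkD
    omega
  have hpos : (0 : ℝ) < (sInf L : ℕ) := by exact_mod_cast Nat.pos_of_ne_zero hi0
  have h4 := hrho k
  rw [← hL, rhoL, if_neg hi0, lt_div_iff₀ hpos] at h4
  have h5 : (r - rhoStar G d) * (sInf L : ℕ) < C := by
    have := mul_le_mul_of_nonneg_right hG0 hpos.le
    linarith
  have hrpos : 0 < r - rhoStar G d := by linarith
  have hkD' : (k : ℝ) ≤ (sInf L : ℕ) * (D : ℝ) := by exact_mod_cast hkD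
  have hNk : (N : ℝ) ≤ k := by exact_mod_cast (by omega : N ≤ k)
  rw [div_lt_iff₀ hrpos] at hN
  have hDnn : (0 : ℝ) ≤ D := Nat.cast_nonneg _
  have h6 := mul_le_mul_of_nonneg_right h5.le hDnn
  have h7 := mul_le_mul_of_nonneg_right (hNk.trans hkD') hrpos.le
  linarith

theorem aap_exists [Fintype G] {G0 : Set G} (hne : deltaG0 G0 ≠ ∅) : ∃ (B0 : Multiset G) (a : ℕ),
    a ∈ lengthSet G0 B0 ∧ 0 < sInf (deltaG0 G0) ∧
    ∀ C : Multiset G, IsZeroSumSeq G0 C → ∀ n : ℕ, IsZeroSumSeq G0 (n • B0 + C) ∧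
      ∃ M, IsAAP (lengthSet G0 (n • B0 + C)) (sInf (deltaG0 G0)) n M := by
  have hmin := Nat.sInf_mem (Set.nonempty_iff_ne_empty.2 hne)
  obtain ⟨B0, hB0, hpos, a, ha, had, -⟩ := mem_deltaG0.1 hmin
  refine ⟨B0, a, ha, hpos, fun C hC n => ?_⟩
  have hz : IsZeroSumSeq G0 (n • B0 + C) := by
    refine ⟨fun g hg => ?_, ?_⟩
    · rcases Multiset.mem_add.1 hg with h | h
      · exact hB0.1 g (Multiset.mem_of_mem_nsmul h)
      · exact hC.1 g h
    · rw [Multiset.sum_add, Multiset.sum_nsmul, hB0.2, hC.2]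
      simp
  refine ⟨hz, ?_⟩
  obtain ⟨c, hc⟩ := lengthSet_nonempty hC
  have hrun : ∀ i ≤ n, (n * a + c) + i * sInf (deltaG0 G0) ∈ lengthSet G0 (n • B0 + C) := by
    intro i hi
    have h1 := nsmul_mem_lengthSet had i
    have h2 := nsmul_mem_lengthSet ha (n - i)
    have h3 := add_mem_lengthSet (add_mem_lengthSet h1 h2) hc
    rw [← add_nsmul, Nat.add_sub_cancel' hi] at h3
    convert h3 using 1
    obtain ⟨j, rfl⟩ := Nat.exists_eq_add_of_le hi
    simp only [Nat.add_sub_cancel_left]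
    ring
  refine isAAP_of (y := n * a + c) hpos (fun x hx => length_le_card hx) hrun ?_
  intro x hx
  have h0 := hrun 0 (Nat.zero_le _)
  rw [zero_mul, add_zero] at h0
  exact min_delta_dvd hne hz h0 hx

theorem min_delta_mem_delta1 [Fintype G] {G0 : Set G} (hne : deltaG0 G0 ≠ ∅) :
    sInf (deltaG0 G0) ∈ delta1 G := by
  obtain ⟨B0, a, ha, hpos, h⟩ := aap_exists hne
  refine ⟨hpos, fun k => ?_⟩
  obtain ⟨h1, M, hM⟩ := h 0 ⟨by simp, by simp⟩ k
  refine ⟨_, ⟨k • B0 + 0, ⟨fun _ _ => trivial, h1.2⟩, rfl⟩, k, le_rfl, M, ?_⟩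
  rw [lengthSet_univ h1.1]
  exact hM

theorem rhoG0_le [Fintype G] {G0 : Set G} (hne : deltaG0 G0 ≠ ∅) :
    rhoG0 G0 ≤ rhoGd G (sInf (deltaG0 G0)) := by
  obtain ⟨B0, a, ha, hpos, h⟩ := aap_exists hne
  refine le_ciInf fun n => ?_
  have hmem : ∀ C : Multiset G, IsZeroSumSeq G0 C →
      rhoL (lengthSet G0 (n • B0 + C)) ≤ rhoGdk G (sInf (deltaG0 G0)) n := by
    intro C hC
    obtain ⟨h1, M, hM⟩ := h C hC n
    refine le_csSup (rhoGdk_bdd _ _) ⟨_, ⟨⟨n • B0 + C, ⟨fun _ _ => trivial, h1.2⟩, ?_⟩,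
      n, le_rfl, M, hM⟩, rfl⟩
    rw [lengthSet_univ h1.1]
  have hsys : (rhoL '' systemL G0).Nonempty :=
    ⟨_, _, ⟨0, ⟨by simp, by simp⟩, rfl⟩, rfl⟩
  refine csSup_le hsys ?_
  rintro _ ⟨_, ⟨C, hC, rfl⟩, rfl⟩
  set R := rhoGdk G (sInf (deltaG0 G0)) n with hR
  have hone : 1 ≤ R := (rhoL_bounds (h C hC n).1).1.trans (hmem C hC)
  have hCne := lengthSet_nonempty hC
  have hi := Nat.sInf_mem hCne
  have hs := Nat.sSup_mem hCne (lengthSet_bdd G0 C)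
  rw [rhoL]
  split_ifs with h0
  · exact hone
  have hipos : (0 : ℝ) < (sInf (lengthSet G0 C) : ℕ) := by
    exact_mod_cast Nat.pos_of_ne_zero h0
  rw [div_le_iff₀ hipos]
  set S := sSup (lengthSet G0 C) with hS
  set I := sInf (lengthSet G0 C) with hI
  -- for all N, N * S + n a ≤ R * (N * I + n a)
  have hN : ∀ N : ℕ, (N : ℝ) * S + n * a ≤ R * (N * I + n * a) := by
    intro N
    have hNC : IsZeroSumSeq G0 (N • C) := by
      refine ⟨fun g hg => hC.1 g (Multiset.mem_of_mem_nsmul hg), ?_⟩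
      rw [Multiset.sum_nsmul, hC.2, smul_zero]
    have hz := (h _ hNC n).1
    have e1 := add_mem_lengthSet (nsmul_mem_lengthSet ha n) (nsmul_mem_lengthSet hs N)
    have e2 := add_mem_lengthSet (nsmul_mem_lengthSet ha n) (nsmul_mem_lengthSet hi N)
    have hm := hmem _ hNC
    set L := lengthSet G0 (n • B0 + N • C) with hL
    have f1 : n * a + N * S ≤ sSup L := le_csSup (lengthSet_bdd _ _) e1
    have f2 : sInf L ≤ n * a + N * I := Nat.sInf_le e2
    have f1' : (n : ℝ) * a + N * S ≤ (sSup L : ℕ) := by exact_mod_cast f1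
    have f2' : ((sInf L : ℕ) : ℝ) ≤ (n : ℝ) * a + N * I := by exact_mod_cast f2
    by_cases hL0 : sInf L = 0
    · have hLi := Nat.sInf_mem (lengthSet_nonempty hz)
      rw [← hL, hL0] at hLi
      have g1 := card_le_length hLi
      have g2 := length_le_card e1
      rw [zero_mul] at g1
      have g3 : n * a + N * S = 0 := by omega
      have g3' : (n : ℝ) * a + N * S = 0 := by exact_mod_cast g3
      have : 0 ≤ R * (N * I + n * a) := by positivity
      linarith
    · have hLpos : (0 : ℝ) < (sInf L : ℕ) := by exact_mod_cast Nat.pos_of_ne_zero hL0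
      rw [rhoL, if_neg hL0, div_le_iff₀ hLpos] at hm
      have := mul_le_mul_of_nonneg_left f2' (zero_le_one.trans hone)
      linarith
  by_contra hcon
  push Not at hcon
  obtain ⟨N, hNN⟩ := exists_nat_gt (R * (n * a) / (S - R * I))
  have hp : (0 : ℝ) < S - R * I := by linarith
  rw [div_lt_iff₀ hp] at hNN
  have h8 := hN N
  have h9 : (0 : ℝ) ≤ (n : ℝ) * a := by positivity
  nlinarith

end Helpers

/-- For a finite abelian group `G` with `D(G) ≥ 4` and
`d ∈ Δ₁(G)`: (a) `ρ*(G, d) ≥ ρ(G, d)`; (b) there is `k₀ ∈ ℕ` with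
`k₀d ∈ Δ₁(G)` and `ρ*(G, d) ≤ ρ(G, k₀d)`; (c) `ρ*(G, d)` is the maximum of
`{ρ(G, kd) : k ∈ ℕ, kd ∈ Δ₁(G)}`. -/
theorem stmt14 {G : Type*} [AddCommGroup G] [Fintype G]
    (hD : 4 ≤ davenport G)
    (d : ℕ) (hd : d ∈ delta1 G) :
    rhoGd G d ≤ rhoStar G d ∧
    (∃ k0 : ℕ, 0 < k0 ∧ k0 * d ∈ delta1 G ∧ rhoStar G d ≤ rhoGd G (k0 * d)) ∧
    IsGreatest {x : ℝ | ∃ k : ℕ, 0 < k ∧ k * d ∈ delta1 G ∧ x = rhoGd G (k * d)}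
      (rhoStar G d) := by
  have hb : ∃ k0 : ℕ, 0 < k0 ∧ k0 * d ∈ delta1 G ∧ rhoStar G d ≤ rhoGd G (k0 * d) := by
    obtain ⟨G0, h1, ⟨k0, hk0⟩, h3⟩ := (rhoStar_nonempty hd).csSup_mem (rhoStar_finite d)
    have hm := min_delta_mem_delta1 h1
    have hle := rhoG0_le h1
    rw [hk0, mul_comm] at hm hle
    refine ⟨k0, ?_, hm, ?_⟩
    · exact Nat.pos_of_mul_pos_right hm.1
    · exact h3.trans_le hle
  have hc : ∀ k : ℕ, k * d ∈ delta1 G → rhoGd G (k * d) ≤ rhoStar G d := by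
    intro k hk
    refine (part_a hk.1).trans (csSup_le_csSup (rhoStar_finite d).bddAbove
      (rhoStar_nonempty hk) ?_)
    rintro _ ⟨G0, h1, h2, rfl⟩
    exact ⟨G0, h1, (Dvd.intro_left k rfl).trans h2, rfl⟩
  refine ⟨part_a hd.1, hb, ?_, ?_⟩
  · obtain ⟨k0, h0, h1, h2⟩ := hb
    exact ⟨k0, h0, h1, le_antisymm h2 (hc k0 h1)⟩
  · rintro _ ⟨k, -, hk, rfl⟩
    exact hc k hk
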